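/- 𝒞_2(6,4,3) = 63; that is, the maximum cardinality of a cyclic code C ⊆ G_2(6,3) with minimum subspace distance at least 4 equals 63. -/

import Mathlib

open Module

/-- The cyclic shift `αV = {αv : v ∈ V}` of an `Fq`-subspace `V` of the extension field `F`
by a field element `α`. -/
def cyclicShift (Fq F : Type*) [Field Fq] [Field F] [Algebra Fq F]
    (α : F) (V : Submodule Fq F) : Submodule Fq F :=
  Submodule.map (LinearMap.mulLeft Fq α) V

/-- The subspace distance `d(U,W) = dim U + dim W − 2 dim (U ∩ W)`. -/
noncomputable def subspaceDist (Fq F : Type*) [Field Fq] [Field F] [Algebra Fq F]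
    (U W : Submodule Fq F) : ℕ :=
  finrank Fq U + finrank Fq W - 2 * finrank Fq ↥(U ⊓ W)

/-- `C` is a cyclic code in the Grassmannian `G_q(n,k)` (all members have dimension `k`,
and `C` is closed under cyclic shifts by nonzero field elements) with minimum subspace
distance at least `d`. -/
def IsCyclicCode (Fq F : Type*) [Field Fq] [Field F] [Algebra Fq F]
    (k d : ℕ) (C : Set (Submodule Fq F)) : Prop :=
  (∀ U ∈ C, finrank Fq U = k) ∧
  (∀ α : F, α ≠ 0 → ∀ U ∈ C, cyclicShift Fq F α U ∈ C) ∧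
  (∀ U ∈ C, ∀ W ∈ C, U ≠ W → d ≤ subspaceDist Fq F U W)

/-- The orbit `orb(V) = {αV : α ∈ F, α ≠ 0}` of a subspace `V`. -/
def orbitOf (Fq F : Type*) [Field Fq] [Field F] [Algebra Fq F]
    (V : Submodule Fq F) : Set (Submodule Fq F) :=
  {W | ∃ α : F, α ≠ 0 ∧ W = cyclicShift Fq F α V}

/-- The set of orbits of members of a code `C`. -/
def orbitsOf (Fq F : Type*) [Field Fq] [Field F] [Algebra Fq F]
    (C : Set (Submodule Fq F)) : Set (Set (Submodule Fq F)) :=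
  {O | ∃ V ∈ C, O = orbitOf Fq F V}

section BinaryField

variable {F : Type*} [Field F] [Algebra (ZMod 2) F]

theorem two_eq_zero_of_binary (F : Type*) [Field F] [Algebra (ZMod 2) F] : (2 : F) = 0 := by
  have h : algebraMap (ZMod 2) F 2 = 0 := by
    rw [show (2 : ZMod 2) = 0 by decide, map_zero]
  rwa [map_ofNat] at h

theorem add_self_of_binary (x : F) : x + x = 0 := by
  linear_combination x * two_eq_zero_of_binary F

theorem mem_cyclicShift {α : F} (hα : α ≠ 0) {V : Submodule (ZMod 2) F} {x : F} :
    x ∈ cyclicShift (ZMod 2) F α V ↔ α⁻¹ * x ∈ V := by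
  simp only [cyclicShift, Submodule.mem_map, LinearMap.mulLeft_apply]
  constructor
  · rintro ⟨y, hy, rfl⟩
    rwa [inv_mul_cancel_left₀ hα]
  · intro h
    exact ⟨_, h, mul_inv_cancel_left₀ hα x⟩

theorem mul_mem_cyclicShift {V : Submodule (ZMod 2) F} {x : F} (α : F) (hx : x ∈ V) :
    α * x ∈ cyclicShift (ZMod 2) F α V :=
  ⟨x, hx, rfl⟩

theorem finrank_cyclicShift {α : F} (hα : α ≠ 0) (V : Submodule (ZMod 2) F) :
    finrank (ZMod 2) (cyclicShift (ZMod 2) F α V) = finrank (ZMod 2) V :=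
  (Submodule.equivMapOfInjective _ (mul_right_injective₀ hα) V).finrank_eq.symm

theorem cyclicShift_cyclicShift {α β : F} (hα : α ≠ 0) (hβ : β ≠ 0) (V : Submodule (ZMod 2) F) :
    cyclicShift (ZMod 2) F α (cyclicShift (ZMod 2) F β V) =
      cyclicShift (ZMod 2) F (α * β) V := by
  ext x
  rw [mem_cyclicShift hα, mem_cyclicShift hβ, mem_cyclicShift (mul_ne_zero hα hβ), mul_inv,
    mul_comm α⁻¹ β⁻¹, mul_assoc]

theorem cyclicShift_one (V : Submodule (ZMod 2) F) : cyclicShift (ZMod 2) F 1 V = V := by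
  ext x
  simp [mem_cyclicShift one_ne_zero]

theorem ncard_coe_eq_two_pow_finrank [Finite F] (S : Submodule (ZMod 2) F) :
    (S : Set F).ncard = 2 ^ finrank (ZMod 2) S := by
  rw [← Nat.card_coe_set_eq]
  have h := Module.natCard_eq_pow_finrank (K := ZMod 2) (V := S)
  rw [Nat.card_zmod] at h
  exact h

theorem two_le_finrank_iff [Finite F] (S : Submodule (ZMod 2) F) :
    2 ≤ finrank (ZMod 2) S ↔ ∃ x ∈ S, ∃ y ∈ S, x ≠ 0 ∧ y ≠ 0 ∧ x ≠ y := by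
  have hc := ncard_coe_eq_two_pow_finrank S
  constructor
  · intro h
    have h4 : 2 ^ 2 ≤ (S : Set F).ncard := hc ▸ Nat.pow_le_pow_right two_pos h
    have h3 := Set.ncard_sdiff_singleton_of_mem (s := (S : Set F)) (zero_mem S)
    obtain ⟨x, hx, y, hy, hxy⟩ := (Set.one_lt_ncard (s := (S : Set F) \ {0})
      (Set.toFinite _)).1 (by omega)
    exact ⟨x, hx.1, y, hy.1, hx.2, hy.2, hxy⟩
  · rintro ⟨x, hx, y, hy, hx0, hy0, hxy⟩
    have h3 := (Set.two_lt_ncard (s := (S : Set F)) (Set.toFinite _)).2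
      ⟨0, zero_mem S, x, hx, y, hy, hx0.symm, hy0.symm, hxy⟩
    by_contra! h
    have : 2 ^ finrank (ZMod 2) S ≤ 2 ^ 1 := Nat.pow_le_pow_right two_pos (by omega)
    omega

theorem IsCyclicCode.eq_of_mem_of_mem [Finite F] {C : Set (Submodule (ZMod 2) F)}
    (hC : IsCyclicCode (ZMod 2) F 3 4 C) {U W : Submodule (ZMod 2) F} (hU : U ∈ C) (hW : W ∈ C)
    {x y : F} (hx0 : x ≠ 0) (hy0 : y ≠ 0) (hxy : x ≠ y) (hxU : x ∈ U) (hyU : y ∈ U)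
    (hxW : x ∈ W) (hyW : y ∈ W) : U = W := by
  by_contra h
  have h1 := hC.2.2 U hU W hW h
  have h2 := (two_le_finrank_iff (U ⊓ W)).2 ⟨x, ⟨hxU, hxW⟩, y, ⟨hyU, hyW⟩, hx0, hy0, hxy⟩
  rw [subspaceDist, hC.1 U hU, hC.1 W hW] at h1
  omega

/-- The nonzero elements of a subspace, as a finite set. -/
noncomputable def nonzeroElements [Finite F] (V : Submodule (ZMod 2) F) : Finset F :=
  (Set.toFinite ((V : Set F) \ {0})).toFinset

theorem mem_nonzeroElements [Finite F] {V : Submodule (ZMod 2) F} {x : F} :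
    x ∈ nonzeroElements V ↔ x ∈ V ∧ x ≠ 0 := by
  simp [nonzeroElements]

theorem card_nonzeroElements [Finite F] {V : Submodule (ZMod 2) F}
    (hV : finrank (ZMod 2) V = 3) : (nonzeroElements V).card = 7 := by
  rw [nonzeroElements, ← Set.ncard_eq_toFinset_card,
    Set.ncard_sdiff_singleton_of_mem (zero_mem V), ncard_coe_eq_two_pow_finrank, hV]
  norm_num

/-- All nonzero elements of `V` have the same seventh power; for three-dimensional subspaces
of the field with 64 elements these are the shifts of the subfield with 8 elements. -/
def HasConstantSeventhPower (V : Submodule (ZMod 2) F) : Prop :=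
  ∀ x ∈ V, ∀ y ∈ V, x ≠ 0 → y ≠ 0 → x ^ 7 = y ^ 7

theorem HasConstantSeventhPower.mem_of_pow_eq [Finite F] {V : Submodule (ZMod 2) F}
    (h : HasConstantSeventhPower V) (hV : finrank (ZMod 2) V = 3) {x y : F} (hx : x ∈ V)
    (hx0 : x ≠ 0) (hxy : y ^ 7 = x ^ 7) : y ∈ V := by
  classical
  have hsub : nonzeroElements V ⊆ (Polynomial.nthRoots 7 (x ^ 7)).toFinset := by
    intro z hz
    rw [mem_nonzeroElements] at hz
    rw [Multiset.mem_toFinset, Polynomial.mem_nthRoots (by norm_num)]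
    exact h z hz.1 x hx hz.2 hx0
  have heq := Finset.eq_of_subset_of_card_le hsub (by
    rw [card_nonzeroElements hV]
    exact (Multiset.toFinset_card_le _).trans (Polynomial.card_nthRoots _ _))
  have hy : y ∈ nonzeroElements V := by
    rw [heq, Multiset.mem_toFinset, Polynomial.mem_nthRoots (by norm_num)]
    exact hxy
  exact (mem_nonzeroElements.1 hy).1

theorem HasConstantSeventhPower.of_cyclicShift_eq [Finite F] {V : Submodule (ZMod 2) F}
    (hV : finrank (ZMod 2) V = 3) {α : F} (hα : α ≠ 0) (hα1 : α ≠ 1)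
    (h : cyclicShift (ZMod 2) F α V = V) : HasConstantSeventhPower V := by
  classical
  have hmul : ∀ x ∈ V, α * x ∈ V := fun x hx => h ▸ mul_mem_cyclicShift α hx
  have hpow : α ^ 7 = 1 := by
    have himg : (nonzeroElements V).image (α * ·) = nonzeroElements V := by
      apply Finset.eq_of_subset_of_card_le
      · intro y hy
        obtain ⟨x, hx, rfl⟩ := Finset.mem_image.1 hy
        rw [mem_nonzeroElements] at hx ⊢
        exact ⟨hmul x hx.1, mul_ne_zero hα hx.2⟩
      · rw [Finset.card_image_of_injective _ (mul_right_injective₀ hα)]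
    have hprod : ∏ x ∈ nonzeroElements V, α * x = ∏ x ∈ nonzeroElements V, x := by
      conv_rhs => rw [← himg]
      rw [Finset.prod_image (mul_right_injective₀ hα).injOn]
    rw [Finset.prod_mul_distrib, Finset.prod_const, card_nonzeroElements hV] at hprod
    refine mul_right_cancel₀ (Finset.prod_ne_zero_iff.2 fun x hx =>
      (mem_nonzeroElements.1 hx).2) (hprod.trans (one_mul _).symm)
  have hord : orderOf α = 7 :=
    have : Fact (Nat.Prime 7) := ⟨by norm_num⟩
    orderOf_eq_prime hpow hα1
  have hpowmem : ∀ x ∈ V, ∀ n : ℕ, α ^ n * x ∈ V := by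
    intro x hx n
    induction n with
    | zero => simpa using hx
    | succ n ih => rw [pow_succ', mul_assoc]; exact hmul _ ih
  intro x hx y hy hx0 hy0
  have himg : (Finset.range 7).image (fun n => α ^ n * x) = nonzeroElements V := by
    apply Finset.eq_of_subset_of_card_le
    · intro z hz
      obtain ⟨n, -, rfl⟩ := Finset.mem_image.1 hz
      exact mem_nonzeroElements.2 ⟨hpowmem x hx n, mul_ne_zero (pow_ne_zero _ hα) hx0⟩
    · rw [card_nonzeroElements hV, Finset.card_image_of_injOn, Finset.card_range]
      intro m hm n hn hmn
      have hm' : m < orderOf α := by simpa [hord] using hm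
      have hn' : n < orderOf α := by simpa [hord] using hn
      exact pow_injOn_Iio_orderOf hm' hn' (mul_right_cancel₀ hx0 hmn)
  have hy' : y ∈ (Finset.range 7).image (fun n => α ^ n * x) := by
    rw [himg]; exact mem_nonzeroElements.2 ⟨hy, hy0⟩
  obtain ⟨n, -, rfl⟩ := Finset.mem_image.1 hy'
  rw [mul_pow, ← pow_mul, mul_comm n, pow_mul, hpow, one_pow, one_mul]

end BinaryField
section Sextic

variable {F : Type*} [Field F] [Algebra (ZMod 2) F]

/-- Zech logarithms for a root `γ` of `X ^ 6 + X + 1` over the field with two elements: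
`γ ^ zechLog i = 1 + γ ^ i` for `0 < i < 63`. -/
def zechLog (i : ℕ) : ℕ :=
  [0, 6, 12, 32, 24, 62, 1, 26, 48, 45, 61, 25, 2, 35, 52, 23, 33, 47, 27, 56, 59, 42, 50, 15, 4,
    11, 7, 18, 41, 60, 46, 34, 3, 16, 31, 13, 54, 44, 49, 43, 55, 28, 21, 39, 37, 9, 30, 17, 8, 38,
    22, 53, 14, 51, 36, 40, 19, 58, 57, 20, 29, 10, 5].getD i 0

/-- Evaluation at `γ` of the polynomial of degree at most five whose coefficients are the binary
digits of `n`. -/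
def binaryEval (γ : F) (n : ℕ) : F :=
  ∑ k ∈ Finset.range 6, ((n.testBit k).toNat : F) * γ ^ k

/-- Multiplication by `X` modulo `X ^ 6 + X + 1`, on binary digits. -/
def mulXMod (n : ℕ) : ℕ :=
  if n < 32 then 2 * n else (2 * n) ^^^ 67

theorem binaryEval_xor (γ : F) (m n : ℕ) :
    binaryEval γ (m ^^^ n) = binaryEval γ m + binaryEval γ n := by
  simp only [binaryEval, ← Finset.sum_add_distrib]
  refine Finset.sum_congr rfl fun k _ => ?_
  rw [Nat.testBit_xor]
  cases m.testBit k <;> cases n.testBit k <;> simp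
  linear_combination -(γ ^ k) * two_eq_zero_of_binary F

theorem binaryEval_mulXMod {γ : F} (hγ : γ ^ 6 = γ + 1) {n : ℕ} (hn : n < 64) :
    binaryEval γ (mulXMod n) = γ * binaryEval γ n := by
  have hbits : ∀ n < 64, (mulXMod n).testBit 0 = n.testBit 5 ∧
      (mulXMod n).testBit 1 = (n.testBit 0 ^^ n.testBit 5) ∧
      (mulXMod n).testBit 2 = n.testBit 1 ∧ (mulXMod n).testBit 3 = n.testBit 2 ∧
      (mulXMod n).testBit 4 = n.testBit 3 ∧ (mulXMod n).testBit 5 = n.testBit 4 := by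
    decide +kernel
  obtain ⟨h0, h1, h2, h3, h4, h5⟩ := hbits n hn
  have hxor : ((n.testBit 0 ^^ n.testBit 5).toNat : F) =
      (n.testBit 0).toNat + (n.testBit 5).toNat := by
    cases n.testBit 0 <;> cases n.testBit 5 <;> simp
    linear_combination -two_eq_zero_of_binary F
  simp only [binaryEval, Finset.sum_range_succ, Finset.sum_range_zero, h0, h1, h2, h3, h4, h5,
    hxor]
  linear_combination -((n.testBit 5).toNat : F) * hγ

theorem mulXMod_lt {n : ℕ} (hn : n < 64) : mulXMod n < 64 := by
  have h : ∀ n < 64, mulXMod n < 64 := by decide +kernel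
  exact h n hn

theorem binaryEval_iterate {γ : F} (hγ : γ ^ 6 = γ + 1) (i : ℕ) :
    mulXMod^[i] 1 < 64 ∧ binaryEval γ (mulXMod^[i] 1) = γ ^ i := by
  induction i with
  | zero => simp [binaryEval, Finset.sum_range_succ, Nat.testBit_succ]
  | succ i ih =>
    rw [Function.iterate_succ_apply', pow_succ', binaryEval_mulXMod hγ ih.1, ih.2]
    exact ⟨mulXMod_lt ih.1, rfl⟩

theorem pow_zechLog {γ : F} (hγ : γ ^ 6 = γ + 1) {i : ℕ} (hi0 : 0 < i) (hi : i < 63) :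
    γ ^ zechLog i = 1 + γ ^ i := by
  have h : ∀ i < 63, 0 < i → mulXMod^[zechLog i] 1 = mulXMod^[0] 1 ^^^ mulXMod^[i] 1 := by
    decide +kernel
  rw [← (binaryEval_iterate hγ (zechLog i)).2, h i hi hi0, binaryEval_xor,
    (binaryEval_iterate hγ 0).2, (binaryEval_iterate hγ i).2, pow_zero]

theorem orderOf_eq_of_sextic {γ : F} (hγ : γ ^ 6 = γ + 1) : orderOf γ = 63 := by
  have h2 := two_eq_zero_of_binary F
  have hpow : ∀ i j, mulXMod^[i] 1 = mulXMod^[j] 1 → γ ^ i = γ ^ j := fun i j h => by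
    rw [← (binaryEval_iterate hγ i).2, h, (binaryEval_iterate hγ j).2]
  apply orderOf_eq_of_pow_and_pow_div_prime (by norm_num)
  · rw [← pow_zero γ]
    exact hpow _ _ (by decide +kernel)
  · intro p hp hdvd h1
    have hp' : p = 3 ∨ p = 7 := by
      rw [show 63 = 3 ^ 2 * 7 by norm_num, hp.dvd_mul] at hdvd
      rcases hdvd with h | h
      · exact .inl ((Nat.prime_dvd_prime_iff_eq hp (by norm_num)).1 (hp.dvd_of_dvd_pow h))
      · exact .inr ((Nat.prime_dvd_prime_iff_eq hp (by norm_num)).1 h)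
    rcases hp' with rfl | rfl
    · have h21 : γ ^ 21 = γ ^ 5 + γ ^ 4 + γ ^ 3 + γ + 1 := by
        rw [← (binaryEval_iterate hγ 21).2, show mulXMod^[21] 1 = 59 by decide +kernel]
        simp [binaryEval, Finset.sum_range_succ, Nat.testBit_succ]
        ring
      exact one_ne_zero (α := F) (by
        linear_combination -(γ ^ 5 + γ ^ 4 + γ ^ 3 + γ + 1) * (h21.symm.trans h1) -
          (γ ^ 4 + γ ^ 2 + 1) * hγ + (γ ^ 10 + γ ^ 9 + 2 * γ ^ 8 + γ ^ 7 + 2 * γ ^ 6 + γ ^ 5 +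
          γ ^ 4) * h2)
    · have h9 : γ ^ 9 = γ ^ 4 + γ ^ 3 := by linear_combination γ ^ 3 * hγ
      exact one_ne_zero (α := F) (by
        linear_combination -(γ ^ 3 + γ ^ 2 + γ + 1) * (h9.symm.trans h1) - γ * hγ +
          (γ ^ 7 + γ ^ 6 + γ ^ 5 + γ ^ 4 - γ ^ 2 - γ) * h2)

theorem exists_sextic_root (hF : Nat.card F = 64) : ∃ γ : F, γ ^ 6 = γ + 1 := by
  classical
  have h2 := two_eq_zero_of_binary F
  have : Finite F := Nat.finite_of_card_ne_zero (by omega)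
  have : Fintype F := Fintype.ofFinite F
  set q : Polynomial F := ∑ i ∈ ({0, 1, 2, 3, 4, 5, 7, 9, 11, 12, 15, 16, 18, 19, 20, 22, 23, 25,
    28, 31, 32, 33, 37, 39, 40, 41, 42, 45, 47, 51, 52, 57} : Finset ℕ), Polynomial.X ^ i with hq
  have hqeval : ∀ x : F, (x ^ 6 + x + 1) * q.eval x = x ^ 63 + 1 := by
    intro x
    simp [hq]
    linear_combination (x + x ^ 2 + x ^ 3 + x ^ 4 + x ^ 5 + x ^ 6 + x ^ 7 + x ^ 8 +
      x ^ 9 + x ^ 10 + x ^ 11 + x ^ 12 + x ^ 13 + x ^ 15 + x ^ 16 + x ^ 17 + x ^ 18 +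
      x ^ 19 + x ^ 20 + x ^ 21 + x ^ 22 + x ^ 23 + x ^ 24 + x ^ 25 + x ^ 26 + x ^ 28 +
      x ^ 29 + x ^ 31 + x ^ 32 + x ^ 33 + x ^ 34 + x ^ 37 + x ^ 38 + x ^ 39 + x ^ 40 +
      x ^ 41 + x ^ 42 + x ^ 43 + x ^ 45 + x ^ 46 + x ^ 47 + x ^ 48 + x ^ 51 + x ^ 52 +
      x ^ 53 + x ^ 57 + x ^ 58) * h2
  have hqdeg : q.natDegree ≤ 57 := by
    refine Polynomial.natDegree_sum_le_of_forall_le _ _ fun i hi => ?_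
    rw [Polynomial.natDegree_X_pow]
    revert i
    decide
  have hq0 : q ≠ 0 := by
    intro h0
    have h1 := hqeval 0
    rw [h0] at h1
    simp at h1
  obtain ⟨x, hx⟩ : ∃ x, x ∉ insert 0 q.roots.toFinset := by
    by_contra! hall
    have hcard := (Finset.card_le_card fun x (_ : x ∈ Finset.univ) => hall x).trans
      ((Finset.card_insert_le _ _).trans (Nat.add_le_add_right
        ((Multiset.toFinset_card_le _).trans ((Polynomial.card_roots' q).trans hqdeg)) 1))
    rw [Finset.card_univ, ← Nat.card_eq_fintype_card, hF] at hcard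
    omega
  rw [Finset.mem_insert, not_or, Multiset.mem_toFinset, Polynomial.mem_roots hq0] at hx
  have hx63 : x ^ 63 = 1 := by
    have h := FiniteField.pow_card_sub_one_eq_one x hx.1
    rwa [← Nat.card_eq_fintype_card, hF] at h
  have hprod : (x ^ 6 + x + 1) * q.eval x = 0 := by
    rw [hqeval, hx63]
    linear_combination h2
  have hroot := (mul_eq_zero.1 hprod).resolve_right hx.2
  exact ⟨x, by linear_combination hroot - (x + 1) * h2⟩

end Sextic

section Orbits

theorem ncard_compl_zero {K : Type*} [Field K] (hF : Nat.card K = 64) :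
    ({0}ᶜ : Set K).ncard = 63 := by
  have : Finite K := Nat.finite_of_card_ne_zero (by omega)
  rw [Set.ncard_compl, hF, Set.ncard_singleton]

variable {F : Type*} [Field F] [Algebra (ZMod 2) F]

theorem orbitOf_symm {U W : Submodule (ZMod 2) F} (h : U ∈ orbitOf (ZMod 2) F W) :
    W ∈ orbitOf (ZMod 2) F U := by
  obtain ⟨α, hα, rfl⟩ := h
  refine ⟨α⁻¹, inv_ne_zero hα, ?_⟩
  rw [cyclicShift_cyclicShift (inv_ne_zero hα) hα, inv_mul_cancel₀ hα, cyclicShift_one]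

theorem orbitOf_eq_image (V : Submodule (ZMod 2) F) :
    orbitOf (ZMod 2) F V = (fun α => cyclicShift (ZMod 2) F α V) '' {0}ᶜ := by
  ext W
  simp [orbitOf, eq_comm]

theorem IsCyclicCode.mem_orbitOf_of_hasConstantSeventhPower [Finite F]
    {C : Set (Submodule (ZMod 2) F)} (hC : IsCyclicCode (ZMod 2) F 3 4 C)
    {U W : Submodule (ZMod 2) F} (hU : U ∈ C) (hW : W ∈ C) (hW7 : HasConstantSeventhPower W)
    {x y : F} (hx : x ∈ U) (hy : y ∈ U) (hx0 : x ≠ 0) (hy0 : y ≠ 0) (hxy : x ≠ y)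
    (h7 : x ^ 7 = y ^ 7) : U ∈ orbitOf (ZMod 2) F W := by
  obtain ⟨w, hw, -, -, hw0, -, -⟩ :=
    (two_le_finrank_iff W).1 (by rw [hC.1 W hW]; norm_num)
  have hα : x / w ≠ 0 := div_ne_zero hx0 hw0
  refine ⟨x / w, hα, hC.eq_of_mem_of_mem hU (hC.2.1 _ hα W hW) hx0 hy0 hxy hx hy ?_ ?_⟩
  · simpa [div_mul_cancel₀ x hw0] using mul_mem_cyclicShift (x / w) hw
  · rw [mem_cyclicShift hα]
    apply hW7.mem_of_pow_eq (hC.1 W hW) hw hw0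
    rw [mul_pow, ← h7, ← mul_pow, inv_div, div_mul_cancel₀ w hx0]

theorem IsCyclicCode.eq_one_of_mem_cyclicShift [Finite F]
    {C : Set (Submodule (ZMod 2) F)} (hC : IsCyclicCode (ZMod 2) F 3 4 C)
    {U : Submodule (ZMod 2) F} (hU : U ∈ C) (hU7 : ¬ HasConstantSeventhPower U)
    {α x y : F} (hα : α ≠ 0) (hx : x ∈ U) (hy : y ∈ U) (hx0 : x ≠ 0) (hy0 : y ≠ 0) (hxy : x ≠ y)
    (hαx : α * x ∈ U) (hαy : α * y ∈ U) : α = 1 := by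
  by_contra hα1
  exact hU7 <| .of_cyclicShift_eq (hC.1 U hU) hα hα1 <|
    hC.eq_of_mem_of_mem (hC.2.1 α hα U hU) hU (mul_ne_zero hα hx0) (mul_ne_zero hα hy0)
      (fun h => hxy (mul_left_cancel₀ hα h)) (mul_mem_cyclicShift α hx)
      (mul_mem_cyclicShift α hy) hαx hαy

open Classical in
/-- The ratios of pairs of distinct nonzero elements of a subspace. -/
noncomputable def ratios [Finite F] (U : Submodule (ZMod 2) F) : Finset F :=
  (nonzeroElements U).offDiag.image fun p => p.2 / p.1

theorem mem_ratios [Finite F] {U : Submodule (ZMod 2) F} {r : F} :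
    r ∈ ratios U ↔ ∃ u ∈ U, ∃ x ∈ U, u ≠ 0 ∧ x ≠ 0 ∧ u ≠ x ∧ x / u = r := by
  simp only [ratios, Finset.mem_image, Finset.mem_offDiag, mem_nonzeroElements, Prod.exists]
  grind

theorem IsCyclicCode.card_ratios [Finite F]
    {C : Set (Submodule (ZMod 2) F)} (hC : IsCyclicCode (ZMod 2) F 3 4 C)
    {U : Submodule (ZMod 2) F} (hU : U ∈ C) (hU7 : ¬ HasConstantSeventhPower U) :
    (ratios U).card = 42 := by
  classical
  rw [ratios, Finset.card_image_of_injOn, Finset.offDiag_card, card_nonzeroElements (hC.1 U hU)]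
  rintro ⟨u, x⟩ hux ⟨u', x'⟩ hux' h
  simp only [Finset.mem_coe, Finset.mem_offDiag, mem_nonzeroElements] at hux hux' h
  obtain ⟨⟨hu, hu0⟩, ⟨hx, hx0⟩, hne⟩ := hux
  obtain ⟨⟨hu', hu0'⟩, ⟨hx', hx0'⟩, hne'⟩ := hux'
  have h1 : u' / u * u = u' := div_mul_cancel₀ u' hu0
  have h2 : u' / u * x = x' := by
    rw [div_eq_div_iff hu0 hu0'] at h
    field_simp
    linear_combination h
  have h3 := hC.eq_one_of_mem_cyclicShift hU hU7 (div_ne_zero hu0' hu0) hu hx hu0 hx0 hne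
    (h1.symm ▸ hu') (h2.symm ▸ hx')
  rw [h3, one_mul] at h1 h2
  rw [h1, h2]

theorem IsCyclicCode.mem_orbitOf_of_not_hasConstantSeventhPower (hF : Nat.card F = 64)
    {C : Set (Submodule (ZMod 2) F)} (hC : IsCyclicCode (ZMod 2) F 3 4 C)
    {U W : Submodule (ZMod 2) F} (hU : U ∈ C) (hW : W ∈ C) (hU7 : ¬ HasConstantSeventhPower U)
    (hW7 : ¬ HasConstantSeventhPower W) : W ∈ orbitOf (ZMod 2) F U := by
  classical
  have : Finite F := Nat.finite_of_card_ne_zero (by omega)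
  have : Fintype F := Fintype.ofFinite F
  by_contra hWU
  have hdisj : Disjoint (ratios U) (ratios W) := by
    rw [Finset.disjoint_left]
    intro r hr hr'
    obtain ⟨u, hu, x, hx, hu0, hx0, hne, rfl⟩ := mem_ratios.1 hr
    obtain ⟨u', hu', x', hx', hu0', hx0', hne', h⟩ := mem_ratios.1 hr'
    have hα : u' / u ≠ 0 := div_ne_zero hu0' hu0
    have h1 : u' / u * u = u' := div_mul_cancel₀ u' hu0
    have h2 : u' / u * x = x' := by
      rw [div_eq_div_iff hu0' hu0] at h
      field_simp
      linear_combination -h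
    exact hWU ⟨u' / u, hα, hC.eq_of_mem_of_mem hW (hC.2.1 _ hα U hU) hu0' hx0' hne' hu' hx'
      (by simpa only [h1] using mul_mem_cyclicShift (u' / u) hu)
      (by simpa only [h2] using mul_mem_cyclicShift (u' / u) hx)⟩
  have hnonzero : ∀ V : Submodule (ZMod 2) F, ratios V ⊆ Finset.univ.erase 0 := by
    intro V r hr
    obtain ⟨u, -, x, -, hu0, hx0, -, rfl⟩ := mem_ratios.1 hr
    exact Finset.mem_erase.2 ⟨div_ne_zero hx0 hu0, Finset.mem_univ _⟩
  have hcard := Finset.card_le_card (Finset.union_subset (hnonzero U) (hnonzero W))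
  rw [Finset.card_union_of_disjoint hdisj, hC.card_ratios hU hU7, hC.card_ratios hW hW7,
    Finset.card_erase_of_mem (Finset.mem_univ _), Finset.card_univ, ← Nat.card_eq_fintype_card,
    hF] at hcard
  omega

theorem pow_eq_pow_iff_of_sextic {γ : F} (hγ : γ ^ 6 = γ + 1) {p q : ℕ} :
    γ ^ p = γ ^ q ↔ p % 63 = q % 63 := by
  have hord := orderOf_eq_of_sextic hγ
  rw [(orderOf_pos_iff.1 (by omega)).pow_eq_pow_iff_modEq, hord, Nat.ModEq]

theorem exists_eq_pow_of_sextic (hF : Nat.card F = 64) {γ : F} (hγ : γ ^ 6 = γ + 1) {x : F}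
    (hx : x ≠ 0) : ∃ i < 63, γ ^ i = x := by
  classical
  have : Finite F := Nat.finite_of_card_ne_zero (by omega)
  have : Fintype F := Fintype.ofFinite F
  have hord := orderOf_eq_of_sextic hγ
  have hγ0 : γ ≠ 0 := by
    rintro rfl
    simp at hγ
  have himg : (Finset.range 63).image (γ ^ ·) = Finset.univ.erase 0 := by
    apply Finset.eq_of_subset_of_card_le
    · intro z hz
      obtain ⟨n, -, rfl⟩ := Finset.mem_image.1 hz
      exact Finset.mem_erase.2 ⟨pow_ne_zero _ hγ0, Finset.mem_univ _⟩
    · rw [Finset.card_erase_of_mem (Finset.mem_univ _), Finset.card_univ,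
        ← Nat.card_eq_fintype_card, hF, Finset.card_image_of_injOn, Finset.card_range]
      intro m hm n hn hmn
      exact pow_injOn_Iio_orderOf (by simpa [hord] using hm) (by simpa [hord] using hn) hmn
  have hx' : x ∈ (Finset.range 63).image (γ ^ ·) := by
    rw [himg]
    exact Finset.mem_erase.2 ⟨hx, Finset.mem_univ _⟩
  simpa using hx'

/-- The exponent of `γ ^ i + γ ^ j`, for distinct exponents `i` and `j` below 63. -/
def sumLog (i j : ℕ) : ℕ :=
  (i + zechLog ((j + 63 - i) % 63)) % 63

/-- The exponents of the nonzero elements of the span of `1`, `γ ^ i` and `γ ^ j`. -/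
def planeLogs (i j : ℕ) : List ℕ :=
  [0, i, j, zechLog i, zechLog j, sumLog i j, zechLog (sumLog i j)]

/-- Whether two exponents in `L` belong to distinct elements with the same seventh power, or the
square of an element with exponent in `L` is a nontrivial product of two such elements. -/
def hasCollision (L : List ℕ) : Bool :=
  (L.any fun p => L.any fun q => (p * 7 % 63).beq (q * 7 % 63) && !(p % 63).beq (q % 63)) ||
    L.any fun p => L.any fun r => L.any fun s =>
      ((p + p) % 63).beq ((r + s) % 63) && !(p % 63).beq (r % 63)

theorem hasCollision_iff (L : List ℕ) : hasCollision L = true ↔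
    (∃ p ∈ L, ∃ q ∈ L, p * 7 % 63 = q * 7 % 63 ∧ p % 63 ≠ q % 63) ∨
    ∃ p ∈ L, ∃ r ∈ L, ∃ s ∈ L, (p + p) % 63 = (r + s) % 63 ∧ p % 63 ≠ r % 63 := by
  simp [hasCollision, ← Bool.not_eq_true]

theorem hasCollision_planeLogs : ∀ i < 63, ∀ j < 63, i ≠ 0 ∧ i < j ∧ sumLog i j ≠ 0 →
    hasCollision (planeLogs i j) = true := by
  decide +kernel

theorem pow_sumLog {γ : F} (hγ : γ ^ 6 = γ + 1) {i j : ℕ} (hi : i < 63) (hj : j < 63)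
    (hij : i ≠ j) : γ ^ sumLog i j = γ ^ i + γ ^ j := by
  have h63 : ∀ n, γ ^ (n % 63) = γ ^ n := fun n => by
    rw [← orderOf_eq_of_sextic hγ, pow_mod_orderOf]
  rw [sumLog, h63, pow_add, pow_zechLog hγ (by omega) (by omega), h63, mul_add, mul_one,
    ← pow_add, ← h63 (i + _), show (i + (j + 63 - i)) % 63 = j by omega]

theorem exists_collision (hF : Nat.card F = 64) {V : Submodule (ZMod 2) F}
    (hV : finrank (ZMod 2) V = 3) (h1 : 1 ∈ V) :
    (∃ x ∈ V, ∃ y ∈ V, x ≠ 0 ∧ y ≠ 0 ∧ x ≠ y ∧ x ^ 7 = y ^ 7) ∨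
    ∃ x ∈ V, ∃ z ∈ V, ∃ w ∈ V, x ≠ 0 ∧ z ≠ 0 ∧ x ≠ z ∧ x * x = z * w := by
  classical
  have : Finite F := Nat.finite_of_card_ne_zero (by omega)
  obtain ⟨γ, hγ⟩ := exists_sextic_root hF
  have hord := orderOf_eq_of_sextic hγ
  have hγ0 : γ ≠ 0 := by
    rintro rfl
    simp at hγ
  have hcard := card_nonzeroElements hV
  obtain ⟨a, ha, ha'⟩ : ∃ a ∈ nonzeroElements V, a ∉ ({1} : Finset F) :=
    Finset.exists_mem_notMem_of_card_lt_card (by rw [hcard]; simp)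
  obtain ⟨b, hb, hb'⟩ : ∃ b ∈ nonzeroElements V, b ∉ ({1, a, 1 + a} : Finset F) :=
    Finset.exists_mem_notMem_of_card_lt_card
      (Finset.card_le_three.trans_lt (by rw [hcard]; norm_num))
  simp only [mem_nonzeroElements, Finset.mem_insert, Finset.mem_singleton, not_or] at ha ha' hb hb'
  obtain ⟨i, hi, rfl⟩ := exists_eq_pow_of_sextic hF hγ ha.2
  obtain ⟨j, hj, rfl⟩ := exists_eq_pow_of_sextic hF hγ hb.2
  have hi0 : i ≠ 0 := by
    rintro rfl
    simp at ha'
  have hj0 : j ≠ 0 := by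
    rintro rfl
    simp at hb'
  have hij : i ≠ j := by
    rintro rfl
    simp at hb'
  have hne : γ ^ i + γ ^ j ≠ 1 := fun h =>
    hb'.2.2 (by linear_combination h - add_self_of_binary (γ ^ i))
  clear ha' hb'
  wlog hlt : i < j generalizing i j
  · exact this j hj hb i hi ha hj0 hi0 hij.symm (by rwa [add_comm]) (by omega)
  have hsum := pow_sumLog hγ hi hj hij
  have hs0 : sumLog i j ≠ 0 := by
    intro h
    rw [h, pow_zero] at hsum
    exact hne hsum.symm
  have hs : sumLog i j < 63 := Nat.mod_lt _ (by norm_num)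
  have hmem : ∀ p ∈ planeLogs i j, γ ^ p ∈ V := by
    simp only [planeLogs, List.forall_mem_cons, List.not_mem_nil, false_imp_iff, implies_true,
      and_true, pow_zechLog hγ (Nat.pos_of_ne_zero hi0) hi,
      pow_zechLog hγ (Nat.pos_of_ne_zero hj0) hj, pow_zechLog hγ (Nat.pos_of_ne_zero hs0) hs,
      hsum, pow_zero]
    exact ⟨h1, ha.1, hb.1, add_mem h1 ha.1, add_mem h1 hb.1, add_mem ha.1 hb.1,
      add_mem h1 (add_mem ha.1 hb.1)⟩
  have hpow := fun p q => pow_eq_pow_iff_of_sextic hγ (p := p) (q := q)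
  rcases (hasCollision_iff _).1 (hasCollision_planeLogs i hi j hj ⟨hi0, hlt, hs0⟩) with
    ⟨p, hp, q, hq, h7, hpq⟩ | ⟨p, hp, r, hr, s, hs, h, hpr⟩
  · refine .inl ⟨_, hmem p hp, _, hmem q hq, pow_ne_zero _ hγ0, pow_ne_zero _ hγ0, ?_, ?_⟩
    · rwa [Ne, hpow]
    · rwa [← pow_mul, ← pow_mul, hpow]
  · refine .inr ⟨_, hmem p hp, _, hmem r hr, _, hmem s hs, pow_ne_zero _ hγ0,
      pow_ne_zero _ hγ0, ?_, ?_⟩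
    · rwa [Ne, hpow]
    · rwa [← pow_add, ← pow_add, hpow]

theorem IsCyclicCode.exists_pow_seven_eq (hF : Nat.card F = 64)
    {C : Set (Submodule (ZMod 2) F)} (hC : IsCyclicCode (ZMod 2) F 3 4 C)
    {U : Submodule (ZMod 2) F} (hU : U ∈ C) :
    ∃ x ∈ U, ∃ y ∈ U, x ≠ 0 ∧ y ≠ 0 ∧ x ≠ y ∧ x ^ 7 = y ^ 7 := by
  have : Finite F := Nat.finite_of_card_ne_zero (by omega)
  obtain ⟨u, hu, v, hv, hu0, hv0, huv⟩ :=
    (two_le_finrank_iff U).1 (by rw [hC.1 U hU]; norm_num)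
  by_cases hU7 : HasConstantSeventhPower U
  · exact ⟨u, hu, v, hv, hu0, hv0, huv, hU7 u hu v hv hu0 hv0⟩
  have hu0' := inv_ne_zero hu0
  have hmem : ∀ x ∈ cyclicShift (ZMod 2) F u⁻¹ U, u * x ∈ U := fun x hx => by
    rwa [mem_cyclicShift hu0', inv_inv] at hx
  rcases exists_collision hF ((finrank_cyclicShift hu0' U).trans (hC.1 U hU))
    (by simpa [hu0] using mul_mem_cyclicShift u⁻¹ hu) with
    ⟨x, hx, y, hy, hx0, hy0, hxy, h7⟩ |
    ⟨x, hx, z, hz, w, hw, hx0, hz0, hxz, h⟩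
  · exact ⟨u * x, hmem x hx, u * y, hmem y hy, mul_ne_zero hu0 hx0, mul_ne_zero hu0 hy0,
      fun h => hxy (mul_left_cancel₀ hu0 h), by rw [mul_pow, mul_pow, h7]⟩
  · exfalso
    have h1 : x / z * (u * z) = u * x := by field_simp
    have h2 : x / z * (u * x) = u * w := by
      field_simp
      linear_combination h
    have h3 := hC.eq_one_of_mem_cyclicShift hU hU7 (div_ne_zero hx0 hz0) (hmem z hz) (hmem x hx)
      (mul_ne_zero hu0 hz0) (mul_ne_zero hu0 hx0) (fun h => hxz (mul_left_cancel₀ hu0 h).symm)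
      (h1.symm ▸ hmem x hx) (h2.symm ▸ hmem w hw)
    exact hxz ((div_eq_one_iff_eq hz0).1 h3)

theorem IsCyclicCode.mem_orbitOf (hF : Nat.card F = 64)
    {C : Set (Submodule (ZMod 2) F)} (hC : IsCyclicCode (ZMod 2) F 3 4 C)
    {U W : Submodule (ZMod 2) F} (hU : U ∈ C) (hW : W ∈ C) : W ∈ orbitOf (ZMod 2) F U := by
  have : Finite F := Nat.finite_of_card_ne_zero (by omega)
  by_cases hU7 : HasConstantSeventhPower U
  · obtain ⟨x, hx, y, hy, hx0, hy0, hxy, h7⟩ := hC.exists_pow_seven_eq hF hW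
    exact hC.mem_orbitOf_of_hasConstantSeventhPower hW hU hU7 hx hy hx0 hy0 hxy h7
  by_cases hW7 : HasConstantSeventhPower W
  · obtain ⟨x, hx, y, hy, hx0, hy0, hxy, h7⟩ := hC.exists_pow_seven_eq hF hU
    exact orbitOf_symm
      (hC.mem_orbitOf_of_hasConstantSeventhPower hU hW hW7 hx hy hx0 hy0 hxy h7)
  exact hC.mem_orbitOf_of_not_hasConstantSeventhPower hF hU hW hU7 hW7

theorem IsCyclicCode.ncard_le (hF : Nat.card F = 64) {C : Set (Submodule (ZMod 2) F)}
    (hC : IsCyclicCode (ZMod 2) F 3 4 C) : C.ncard ≤ 63 := by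
  have : Finite F := Nat.finite_of_card_ne_zero (by omega)
  rcases C.eq_empty_or_nonempty with rfl | ⟨U, hU⟩
  · simp
  · have hsub : C ⊆ orbitOf (ZMod 2) F U := fun W hW => hC.mem_orbitOf hF hU hW
    rw [orbitOf_eq_image] at hsub
    exact (Set.ncard_le_ncard hsub (Set.toFinite _)).trans
      ((Set.ncard_image_le (Set.toFinite _)).trans (ncard_compl_zero hF).le)

end Orbits

section Sidon

variable {F : Type*} [Field F] [Algebra (ZMod 2) F]

/-- A Sidon space: products of two nonzero elements determine their factors. -/
def IsSidonSpace (V : Submodule (ZMod 2) F) : Prop :=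
  ∀ a ∈ V, ∀ b ∈ V, ∀ c ∈ V, ∀ d ∈ V, a ≠ 0 → b ≠ 0 → c ≠ 0 → d ≠ 0 → a * b = c * d →
    a = c ∨ a = d

theorem IsSidonSpace.finrank_inf_le_one [Finite F] {V : Submodule (ZMod 2) F}
    (h : IsSidonSpace V) {α β : F} (hα : α ≠ 0) (hβ : β ≠ 0) (hαβ : α ≠ β) :
    finrank (ZMod 2)
      ↥(cyclicShift (ZMod 2) F α V ⊓ cyclicShift (ZMod 2) F β V) ≤ 1 := by
  by_contra! h2
  obtain ⟨x, hx, y, hy, hx0, hy0, hxy⟩ := (two_le_finrank_iff _).1 h2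
  rw [Submodule.mem_inf, mem_cyclicShift hα, mem_cyclicShift hβ] at hx hy
  have hα' := inv_ne_zero hα
  have hβ' := inv_ne_zero hβ
  rcases h _ hx.1 _ hy.2 _ hy.1 _ hx.2 (mul_ne_zero hα' hx0) (mul_ne_zero hβ' hy0)
    (mul_ne_zero hα' hy0) (mul_ne_zero hβ' hx0) (by ring) with h | h
  · exact hxy (mul_left_cancel₀ hα' h)
  · exact hαβ (inv_injective (mul_right_cancel₀ hx0 h))

theorem IsSidonSpace.isCyclicCode_orbitOf [Finite F] {V : Submodule (ZMod 2) F}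
    (h : IsSidonSpace V) (hV : finrank (ZMod 2) V = 3) :
    IsCyclicCode (ZMod 2) F 3 4 (orbitOf (ZMod 2) F V) := by
  refine ⟨?_, ?_, ?_⟩
  · rintro _ ⟨α, hα, rfl⟩
    exact (finrank_cyclicShift hα V).trans hV
  · rintro α hα _ ⟨β, hβ, rfl⟩
    exact ⟨α * β, mul_ne_zero hα hβ, cyclicShift_cyclicShift hα hβ V⟩
  · rintro _ ⟨α, hα, rfl⟩ _ ⟨β, hβ, rfl⟩ hne
    have h1 := h.finrank_inf_le_one hα hβ (fun h => hne (h ▸ rfl))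
    rw [subspaceDist, finrank_cyclicShift hα, finrank_cyclicShift hβ, hV]
    omega

theorem IsSidonSpace.ncard_orbitOf (hF : Nat.card F = 64) {V : Submodule (ZMod 2) F}
    (h : IsSidonSpace V) (hV : finrank (ZMod 2) V = 3) : (orbitOf (ZMod 2) F V).ncard = 63 := by
  have : Finite F := Nat.finite_of_card_ne_zero (by omega)
  rw [orbitOf_eq_image, Set.InjOn.ncard_image, ncard_compl_zero hF]
  intro α hα β hβ hαβ
  by_contra hne
  have h1 := h.finrank_inf_le_one hα hβ hne
  simp only at hαβ
  rw [← hαβ, inf_idem, finrank_cyclicShift hα, hV] at h1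
  omega

/-- The exponents of the nonzero elements of the span of `1`, `γ` and `γ ^ 4`. -/
def sidonLogs : Finset ℕ := {0, 1, 4, 6, 16, 24, 33}

theorem exists_isSidonSpace (hF : Nat.card F = 64) :
    ∃ V : Submodule (ZMod 2) F, finrank (ZMod 2) V = 3 ∧ IsSidonSpace V := by
  classical
  have : Finite F := Nat.finite_of_card_ne_zero (by omega)
  obtain ⟨γ, hγ⟩ := exists_sextic_root hF
  have hord := orderOf_eq_of_sextic hγ
  have hγ0 : γ ≠ 0 := by
    rintro rfl
    simp at hγ
  have hclosed : ∀ p ∈ sidonLogs, ∀ q ∈ sidonLogs, p ≠ q →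
      ∃ r ∈ sidonLogs, γ ^ p + γ ^ q = γ ^ r := by
    have hlt : ∀ p ∈ sidonLogs, p < 63 := by decide
    have hsum : ∀ p ∈ sidonLogs, ∀ q ∈ sidonLogs, p ≠ q → sumLog p q ∈ sidonLogs := by
      decide +kernel
    exact fun p hp q hq hpq =>
      ⟨sumLog p q, hsum p hp q hq hpq, (pow_sumLog hγ (hlt p hp) (hlt q hq) hpq).symm⟩
  let S : AddSubgroup F :=
    { carrier := {x | x = 0 ∨ ∃ p ∈ sidonLogs, x = γ ^ p}
      zero_mem' := .inl rfl
      add_mem' := by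
        rintro x y (rfl | ⟨p, hp, rfl⟩) (rfl | ⟨q, hq, rfl⟩)
        · exact .inl (add_zero 0)
        · exact .inr ⟨q, hq, zero_add _⟩
        · exact .inr ⟨p, hp, add_zero _⟩
        · by_cases hpq : p = q
          · exact .inl (hpq ▸ add_self_of_binary _)
          · exact .inr (hclosed p hp q hq hpq)
      neg_mem' := by
        intro x hx
        rwa [neg_eq_of_add_eq_zero_left (add_self_of_binary x)] }
  have hmem : ∀ x, x ∈ AddSubgroup.toZModSubmodule 2 S ↔ x = 0 ∨ ∃ p ∈ sidonLogs, x = γ ^ p :=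
    fun x => Iff.rfl
  refine ⟨AddSubgroup.toZModSubmodule 2 S, ?_, ?_⟩
  · have hcoe : (AddSubgroup.toZModSubmodule 2 S : Set F) =
        (insert 0 (sidonLogs.image (γ ^ ·)) : Finset F) := by
      ext x
      rw [SetLike.mem_coe, hmem]
      simp [eq_comm]
    have hcard := ncard_coe_eq_two_pow_finrank (AddSubgroup.toZModSubmodule 2 S)
    rw [hcoe, Set.ncard_coe_finset, Finset.card_insert_of_notMem (by simp [hγ0]),
      Finset.card_image_of_injOn] at hcard
    · exact Nat.pow_right_injective le_rfl (hcard.symm.trans (by decide))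
    · intro m hm n hn hmn
      have hlt : ∀ p ∈ sidonLogs, p < 63 := by decide
      exact pow_injOn_Iio_orderOf (by simpa [hord] using hlt m hm) (by simpa [hord] using hlt n hn)
        hmn
  · intro a ha b hb c hc d hd ha0 hb0 hc0 hd0 h
    obtain ⟨p, hp, rfl⟩ := ((hmem a).1 ha).resolve_left ha0
    obtain ⟨q, hq, rfl⟩ := ((hmem b).1 hb).resolve_left hb0
    obtain ⟨r, hr, rfl⟩ := ((hmem c).1 hc).resolve_left hc0
    obtain ⟨s, hs, rfl⟩ := ((hmem d).1 hd).resolve_left hd0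
    rw [← pow_add, ← pow_add, pow_eq_pow_iff_of_sextic hγ] at h
    have hsidon : ∀ p ∈ sidonLogs, ∀ q ∈ sidonLogs, ∀ r ∈ sidonLogs, ∀ s ∈ sidonLogs,
        (p + q) % 63 = (r + s) % 63 → p = r ∨ p = s := by
      decide +kernel
    exact (hsidon p hp q hq r hr s hs h).imp (congrArg (γ ^ ·)) (congrArg (γ ^ ·))

end Sidon

/-- 𝒞_2(6,4,3) = 63. -/
theorem C2_greatest :
    IsGreatest {m : ℕ | ∃ C : Set (Submodule (ZMod 2) (GaloisField 2 6)),
      IsCyclicCode (ZMod 2) (GaloisField 2 6) 3 4 C ∧ C.ncard = m} 63 := by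
  have hF : Nat.card (GaloisField 2 6) = 64 := GaloisField.card 2 6 (by norm_num)
  have : Finite (GaloisField 2 6) := Nat.finite_of_card_ne_zero (by omega)
  refine ⟨?_, ?_⟩
  · obtain ⟨V, hV, hS⟩ := exists_isSidonSpace hF
    exact ⟨_, hS.isCyclicCode_orbitOf hV, hS.ncard_orbitOf hF hV⟩
  · rintro _ ⟨C, hC, rfl⟩
    exact hC.ncard_le hF
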